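/- arXiv:math/9907200 — 2 statements merged into one kernel-verified Lean document; each statement's English description precedes it below -/
import Mathlib

section
/- Let $R$ be a commutative ring, $M$ an $R$-module, $B : M \to M \to R$ an $R$-bilinear form, and $\delta_1, \dots, \delta_r \in M$. For $\delta \in M$ let $T_\delta : M \to M$ be the Picard–Lefschetz transvection $a \mapsto a + B(a,\delta)\,\delta$. Define $\varphi : M \to R^r$ by $\varphi(u)_i = B\big((T_{\delta_{i-1}} \circ \cdots \circ T_{\delta_1})(u),\, \delta_i\big)$ (with the empty composite being the identity when $i = 1$) and $\psi : R^r \to M$ by $\psi(a) = \sum_{i=1}^r a_i\, \delta_i$. If the composite monodromy relation $T_{\delta_r} \circ T_{\delta_{r-1}} \circ \cdots \circ T_{\delta_1} = \mathrm{id}_M$ holds, then $\psi \circ \varphi = 0$, i.e. the sequence $M \xrightarrow{\varphi} R^r \xrightarrow{\psi} M$ is a chain complex. -/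
open scoped BigOperators

variable {R : Type*} [CommRing R] {M : Type*} [AddCommGroup M] [Module R M]

/-- The Picard–Lefschetz transvection `a ↦ a + B(a,δ) • δ` associated to a bilinear
form `B` and an element `δ`. -/
def picardLefschetz (B : M →ₗ[R] M →ₗ[R] R) (δ : M) (a : M) : M :=
  a + B a δ • δ

/-- The composite `T_{δ_n} ∘ ⋯ ∘ T_{δ_1}` of the first `n` Picard–Lefschetz
transvections associated to `δ : Fin r → M` (the identity for `n = 0`). -/
def picardLefschetzIter (B : M →ₗ[R] M →ₗ[R] R) {r : ℕ} (δ : Fin r → M) : ℕ → M → M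
  | 0, a => a
  | n + 1, a =>
      if h : n < r then picardLefschetz B (δ ⟨n, h⟩) (picardLefschetzIter B δ n a)
      else picardLefschetzIter B δ n a

/-- Applying the first `n` transvections to `u` adds the sum of the increments
`B (T_{δ_{i-1}} ⋯ T_{δ_1} u) δ_i • δ_i`. -/
theorem picardLefschetzIter_eq_add_sum (B : M →ₗ[R] M →ₗ[R] R) {r : ℕ} (δ : Fin r → M)
    (u : M) (n : ℕ) (hn : n ≤ r) :
    picardLefschetzIter B δ n u =
      u + ∑ i : Fin n, B (picardLefschetzIter B δ i.1 u) (δ (i.castLE hn)) • δ (i.castLE hn) := by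
  induction n with
  | zero => simp [picardLefschetzIter]
  | succ n ih =>
    rw [Fin.sum_univ_castSucc, ← add_assoc, picardLefschetzIter,
      dif_pos (Nat.lt_of_succ_le hn), picardLefschetz]
    exact congrArg (· + _) (ih (Nat.le_of_succ_le hn))

/-- **The Lefschetz complex is a complex.**
If the composite monodromy relation `T_{δ_r} ∘ ⋯ ∘ T_{δ_1} = id` holds, then with
`φ(u) i = B((T_{δ_{i-1}} ∘ ⋯ ∘ T_{δ_1}) u, δ_i)` and `ψ(a) = ∑ i, a i • δ i` we have
`ψ ∘ φ = 0`. -/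
theorem psi_comp_phi_eq_zero
    (B : M →ₗ[R] M →ₗ[R] R) {r : ℕ} (δ : Fin r → M)
    (φ : M → Fin r → R) (ψ : (Fin r → R) → M)
    (hφ : ∀ u i, φ u i = B (picardLefschetzIter B δ i.1 u) (δ i))
    (hψ : ∀ a, ψ a = ∑ i, a i • δ i)
    (hrel : ∀ a : M, picardLefschetzIter B δ r a = a) :
    ∀ u : M, ψ (φ u) = 0 := by
  intro u
  have h := picardLefschetzIter_eq_add_sum B δ u r le_rfl
  rw [hrel, left_eq_add] at h
  simpa [hψ, hφ] using h
end

section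
/- Let $k$ be a field, let $R = k[x, y]$ be the polynomial ring in two variables, and regard $R$ as an algebra over $S = k[t]$ via the $k$-algebra map sending $t \mapsto xy$. Then the $R$-linear map from the module of Kähler differentials $\Omega_{R/S}$ to $R$ determined by $dx \mapsto x$ and $dy \mapsto -y$ is well defined and injective, and its image is the ideal $(x, y)$ of $R$; in particular $\Omega_{R/S}$ is isomorphic as an $R$-module to the ideal $(x, y)$. -/
open MvPolynomial

/-- The `k`-algebra structure on `k[x,y]` over `k[t]` given by `t ↦ x * y`. -/
noncomputable def xyAlgebra (k : Type*) [Field k] :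
    Algebra (Polynomial k) (MvPolynomial (Fin 2) k) :=
  ((Polynomial.aeval (X 0 * X 1 : MvPolynomial (Fin 2) k)).toRingHom).toAlgebra

namespace XYAlgebra

variable (k : Type*) [Field k]

attribute [local instance] xyAlgebra

local notation "𝓡" => MvPolynomial (Fin 2) k
local notation "𝓢" => Polynomial k

theorem algebraMap_apply (p : 𝓢) :
    algebraMap 𝓢 𝓡 p = Polynomial.aeval (X 0 * X 1 : 𝓡) p :=
  rfl

/-- The derivation `x ∂/∂x - y ∂/∂y` of `k[x,y]`, which is linear over `k[xy]`. -/
noncomputable def eulerDerivation : Derivation 𝓢 𝓡 𝓡 :=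
  let D : Derivation k 𝓡 𝓡 := mkDerivation k ![X 0, -X 1]
  have hD : ∀ p : 𝓢, D (algebraMap 𝓢 𝓡 p) = 0 := fun p => by
    have hxy : D (X 0 * X 1) = 0 := by
      simp only [D, Derivation.leibniz, mkDerivation_X, Matrix.cons_val_zero,
        Matrix.cons_val_one, smul_eq_mul]
      ring
    rw [algebraMap_apply, Derivation.map_aeval, hxy, smul_zero]
  Derivation.mk'
    { toFun := D
      map_add' := map_add D
      map_smul' := fun p r => by
        rw [Algebra.smul_def, Derivation.leibniz, hD, smul_zero, add_zero, RingHom.id_apply,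
          smul_eq_mul, Algebra.smul_def] }
    D.leibniz

theorem eulerDerivation_X_zero : eulerDerivation k (X 0) = X 0 :=
  mkDerivation_X k ![X 0, -X 1] 0

theorem eulerDerivation_X_one : eulerDerivation k (X 1) = -X 1 :=
  mkDerivation_X k ![X 0, -X 1] 1

theorem D_mem_span (p : 𝓡) : KaehlerDifferential.D 𝓢 𝓡 p ∈
    Submodule.span 𝓡 {KaehlerDifferential.D 𝓢 𝓡 (X 0), KaehlerDifferential.D 𝓢 𝓡 (X 1)} := by
  induction p using MvPolynomial.induction_on with
  | C c =>
    have h : (C c : 𝓡) = algebraMap 𝓢 𝓡 (Polynomial.C c) := by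
      rw [algebraMap_apply, Polynomial.aeval_C, MvPolynomial.algebraMap_eq]
    rw [h, Derivation.map_algebraMap]
    exact Submodule.zero_mem _
  | add p q hp hq =>
    rw [map_add]
    exact Submodule.add_mem _ hp hq
  | mul_X p i hp =>
    rw [Derivation.leibniz]
    refine Submodule.add_mem _ (Submodule.smul_mem _ _ (Submodule.subset_span ?_))
      (Submodule.smul_mem _ _ hp)
    fin_cases i <;> simp

theorem span_D_X_eq_top :
    Submodule.span 𝓡 {KaehlerDifferential.D 𝓢 𝓡 (X 0), KaehlerDifferential.D 𝓢 𝓡 (X 1)} = ⊤ := by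
  rw [eq_top_iff, ← KaehlerDifferential.span_range_derivation, Submodule.span_le]
  rintro _ ⟨p, rfl⟩
  exact D_mem_span k p

theorem X_one_smul_D_add_X_zero_smul_D :
    (X 1 : 𝓡) • KaehlerDifferential.D 𝓢 𝓡 (X 0) + (X 0 : 𝓡) • KaehlerDifferential.D 𝓢 𝓡 (X 1)
      = 0 := by
  have h : (X 0 * X 1 : 𝓡) = algebraMap 𝓢 𝓡 Polynomial.X := by
    rw [algebraMap_apply, Polynomial.aeval_X]
  rw [add_comm, ← Derivation.leibniz, h, Derivation.map_algebraMap]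

theorem exists_of_mul_X_zero_eq_mul_X_one {a b : 𝓡} (h : a * X 0 = b * X 1) :
    ∃ c, a = c * X 1 ∧ b = c * X 0 := by
  have hdvd : (X 1 : 𝓡) ∣ a := by
    have hmul : (X 1 : 𝓡) ∣ a * X 0 := ⟨b, h.trans (mul_comm _ _)⟩
    exact (X_prime.dvd_or_dvd hmul).resolve_right (by simp [X_dvd_X])
  obtain ⟨c, rfl⟩ := hdvd
  refine ⟨c, mul_comm _ _, mul_right_cancel₀ (X_ne_zero (R := k) (1 : Fin 2)) ?_⟩
  rw [← h]
  ring

theorem liftKaehlerDifferential_eulerDerivation_injective :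
    Function.Injective (eulerDerivation k).liftKaehlerDifferential := by
  rw [injective_iff_map_eq_zero]
  intro w hw
  have hmem := Submodule.mem_top (R := 𝓡) (x := w)
  rw [← span_D_X_eq_top, Submodule.mem_span_pair] at hmem
  obtain ⟨a, b, rfl⟩ := hmem
  rw [map_add, map_smul, map_smul, Derivation.liftKaehlerDifferential_comp_D,
    Derivation.liftKaehlerDifferential_comp_D, eulerDerivation_X_zero, eulerDerivation_X_one,
    smul_eq_mul, smul_eq_mul, mul_neg, add_neg_eq_zero] at hw
  obtain ⟨c, rfl, rfl⟩ := exists_of_mul_X_zero_eq_mul_X_one k hw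
  rw [mul_smul, mul_smul, ← smul_add, X_one_smul_D_add_X_zero_smul_D, smul_zero]

theorem range_liftKaehlerDifferential_eulerDerivation :
    LinearMap.range (eulerDerivation k).liftKaehlerDifferential =
      (Ideal.span {(X 0 : 𝓡), X 1} : Ideal 𝓡) := by
  rw [LinearMap.range_eq_map, ← span_D_X_eq_top, Submodule.map_span, Set.image_pair,
    Derivation.liftKaehlerDifferential_comp_D, Derivation.liftKaehlerDifferential_comp_D,
    eulerDerivation_X_zero, eulerDerivation_X_one, Ideal.span, Submodule.span_insert,
    Submodule.span_insert, ← Set.neg_singleton, Submodule.span_neg]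

end XYAlgebra

/-- **The relative differentials of the local model of a Lefschetz critical point.**
Let `R = k[x,y]`, `S = k[t]` with `t ↦ xy`.  The `R`-linear map
`Ω_{R/S} → R` determined by `dx ↦ x`, `dy ↦ -y` is well defined and injective and
its image is the ideal `(x, y)`; in particular `Ω_{R/S}` is isomorphic as an
`R`-module to the ideal `(x, y)`. -/
theorem kaehlerDifferential_local_model (k : Type*) [Field k] :
    letI := xyAlgebra k
    ∃ f : Ω[MvPolynomial (Fin 2) k⁄Polynomial k] →ₗ[MvPolynomial (Fin 2) k]
        MvPolynomial (Fin 2) k,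
      f (KaehlerDifferential.D (Polynomial k) (MvPolynomial (Fin 2) k) (X 0)) = X 0 ∧
      f (KaehlerDifferential.D (Polynomial k) (MvPolynomial (Fin 2) k) (X 1)) = -(X 1) ∧
      Function.Injective f ∧
      LinearMap.range f =
        (Ideal.span {(X 0 : MvPolynomial (Fin 2) k), X 1} :
          Ideal (MvPolynomial (Fin 2) k)) ∧
      Nonempty (Ω[MvPolynomial (Fin 2) k⁄Polynomial k] ≃ₗ[MvPolynomial (Fin 2) k]
        (Ideal.span {(X 0 : MvPolynomial (Fin 2) k), X 1} :
          Ideal (MvPolynomial (Fin 2) k))) := by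
  let := xyAlgebra k
  have hinj := XYAlgebra.liftKaehlerDifferential_eulerDerivation_injective k
  have hrange := XYAlgebra.range_liftKaehlerDifferential_eulerDerivation k
  refine ⟨(XYAlgebra.eulerDerivation k).liftKaehlerDifferential, ?_, ?_, hinj, hrange,
    ⟨(LinearEquiv.ofInjective _ hinj).trans (LinearEquiv.ofEq _ _ hrange)⟩⟩
  · rw [Derivation.liftKaehlerDifferential_comp_D, XYAlgebra.eulerDerivation_X_zero]
  · rw [Derivation.liftKaehlerDifferential_comp_D, XYAlgebra.eulerDerivation_X_one]
end
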